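/- arXiv:2307.04957 — 5 statements merged into one kernel-verified Lean document; each statement's English description precedes it below -/
import Mathlib

section
/- Suppose g : ℝ → ℝ → ℝ satisfies: for all a, b, c ∈ ℝ, |g(a,b) − g(a,c)| ≤ |b − c|. Then for any two value functions Q¹, Q² : S × A → ℝ, the generalized Bellman optimality operator satisfies ‖F*Q¹ − F*Q²‖_∞ ≤ γ · ‖Q¹ − Q²‖_∞; that is, F* is a contraction mapping on the space of value functions with the supremum norm, with Lipschitz constant γ. -/
open Finset

theorem Finset.abs_sup'_sub_sup'_le {ι : Type*} {s : Finset ι} (hs : s.Nonempty)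
    {f h : ι → ℝ} {C : ℝ} (hC : ∀ i ∈ s, |f i - h i| ≤ C) :
    |s.sup' hs f - s.sup' hs h| ≤ C := by
  rw [abs_sub_le_iff, sub_le_iff_le_add, sub_le_iff_le_add]
  constructor <;> refine sup'_le hs _ fun i hi => ?_
  · linarith [le_sup' h hi, (abs_sub_le_iff.1 (hC i hi)).1]
  · linarith [le_sup' f hi, (abs_sub_le_iff.1 (hC i hi)).2]

theorem generalized_bellman_optimality_operator_contraction
    {S A R : Type*} [Fintype S] [Nonempty S] [Fintype A] [Nonempty A] [Fintype R]
    (ρ : R → ℝ) (p : S × A → R × S → ℝ)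
    (hp_nonneg : ∀ sa : S × A, ∀ x : R × S, 0 ≤ p sa x)
    (hp_sum : ∀ sa : S × A, ∑ x : R × S, p sa x = 1)
    (γ : ℝ) (hγ : γ ∈ Set.Ioo (0 : ℝ) 1)
    (g : ℝ → ℝ → ℝ)
    (hg : ∀ a b c : ℝ, |g a b - g a c| ≤ |b - c|)
    (Fstar : (S × A → ℝ) → (S × A → ℝ))
    (hFstar : ∀ (Q : S × A → ℝ) (sa : S × A),
      Fstar Q sa = ∑ x : R × S,
        p sa x * g (ρ x.1) (γ * univ.sup' univ_nonempty (fun a' => Q (x.2, a'))))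
    (Q1 Q2 : S × A → ℝ) :
    ‖Fstar Q1 - Fstar Q2‖ ≤ γ * ‖Q1 - Q2‖ := by
  have hmax (s : S) : |univ.sup' univ_nonempty (fun a' => Q1 (s, a')) -
      univ.sup' univ_nonempty (fun a' => Q2 (s, a'))| ≤ ‖Q1 - Q2‖ :=
    abs_sup'_sub_sup'_le univ_nonempty fun a' _ => norm_le_pi_norm (Q1 - Q2) (s, a')
  refine (pi_norm_le_iff_of_nonneg (mul_nonneg hγ.1.le (norm_nonneg _))).2 fun sa => ?_
  rw [Pi.sub_apply, hFstar, hFstar, ← sum_sub_distrib, Real.norm_eq_abs]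
  calc
    _ ≤ ∑ x : R × S, p sa x * (γ * ‖Q1 - Q2‖) := by
      refine (abs_sum_le_sum_abs _ _).trans (sum_le_sum fun x _ => ?_)
      rw [← mul_sub, abs_mul, abs_of_nonneg (hp_nonneg sa x)]
      refine mul_le_mul_of_nonneg_left ((hg _ _ _).trans ?_) (hp_nonneg sa x)
      rw [← mul_sub, abs_mul, abs_of_pos hγ.1]
      exact mul_le_mul_of_nonneg_left (hmax x.2) hγ.1.le
    _ = γ * ‖Q1 - Q2‖ := by rw [← sum_mul, hp_sum, one_mul]
end

section
/- Suppose g : ℝ → ℝ → ℝ satisfies: for all a, b, c ∈ ℝ, |g(a,b) − g(a,c)| ≤ |b − c|. Then for every deterministic policy π : S → A, the generalized policy evaluation operator F^π is a contraction with Lipschitz constant γ in the supremum norm: for any Q¹, Q² : S × A → ℝ, ‖F^π Q¹ − F^π Q²‖_∞ ≤ γ · ‖Q¹ − Q²‖_∞; in particular, F^π has a unique fixed point. -/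
open Finset

theorem policy_evaluation_operator_contraction
    {S A : Type*} [Fintype S] [Nonempty S] [Fintype A] [Nonempty A]
    (r : S × A → ℝ) (T : S × A → S)
    (γ : ℝ) (hγ : γ ∈ Set.Ioo (0 : ℝ) 1)
    (g : ℝ → ℝ → ℝ)
    (hg : ∀ a b c : ℝ, |g a b - g a c| ≤ |b - c|)
    (π : S → A)
    (Fpi : (S × A → ℝ) → (S × A → ℝ))
    (hFpi : ∀ (Q : S × A → ℝ) (sa : S × A),
      Fpi Q sa = g (r sa) (γ * Q (T sa, π (T sa)))) :
    (∀ Q1 Q2 : S × A → ℝ, ‖Fpi Q1 - Fpi Q2‖ ≤ γ * ‖Q1 - Q2‖) ∧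
    (∃! Qpi : S × A → ℝ, Fpi Qpi = Qpi) := by
  obtain ⟨hγ0, hγ1⟩ := hγ
  have hcontr : ∀ Q1 Q2 : S × A → ℝ, ‖Fpi Q1 - Fpi Q2‖ ≤ γ * ‖Q1 - Q2‖ := by
    intro Q1 Q2
    refine (pi_norm_le_iff_of_nonneg (by positivity)).2 fun sa => ?_
    rw [Pi.sub_apply, hFpi, hFpi, Real.norm_eq_abs]
    refine (hg _ _ _).trans ?_
    rw [← mul_sub, abs_mul, abs_of_pos hγ0]
    exact mul_le_mul_of_nonneg_left (norm_le_pi_norm (Q1 - Q2) _) hγ0.le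
  have hF : ContractingWith ⟨γ, hγ0.le⟩ Fpi :=
    ⟨hγ1, LipschitzWith.of_dist_le_mul fun Q1 Q2 => by
      rw [dist_eq_norm, dist_eq_norm]
      exact hcontr Q1 Q2⟩
  exact ⟨hcontr, hF.fixedPoint Fpi, hF.fixedPoint_isFixedPt,
    fun Q hQ => hF.fixedPoint_unique hQ⟩
end

section
/- Suppose g : ℝ → ℝ → ℝ satisfies both: (i) for all a, b, c ∈ ℝ, |g(a,b) − g(a,c)| ≤ |b − c|, and (ii) for all a, b, c ∈ ℝ, if b ≥ c then g(a,b) ≥ g(a,c). Let Q* be the unique fixed point of the generalized Bellman optimality operator F*. Then for every deterministic policy π : S → A, the unique fixed point Q^π of the policy evaluation operator F^π satisfies Q^π(s,a) ≤ Q*(s,a) for all (s,a) ∈ S × A. -/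
open Finset

theorem policy_fixed_point_le_optimal_fixed_point
    {S A : Type*} [Fintype S] [Nonempty S] [Fintype A] [Nonempty A]
    (r : S × A → ℝ) (T : S × A → S)
    (γ : ℝ) (hγ : γ ∈ Set.Ioo (0 : ℝ) 1)
    (g : ℝ → ℝ → ℝ)
    (hg1 : ∀ a b c : ℝ, |g a b - g a c| ≤ |b - c|)
    (hg2 : ∀ a b c : ℝ, b ≥ c → g a b ≥ g a c)
    (Fstar : (S × A → ℝ) → (S × A → ℝ))
    (hFstar : ∀ (Q : S × A → ℝ) (sa : S × A),
      Fstar Q sa = g (r sa) (γ * univ.sup' univ_nonempty (fun a' => Q (T sa, a'))))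
    (Qstar : S × A → ℝ)
    (hQstar : Fstar Qstar = Qstar)
    (hQstar_unique : ∀ Q : S × A → ℝ, Fstar Q = Q → Q = Qstar)
    (π : S → A)
    (Fpi : (S × A → ℝ) → (S × A → ℝ))
    (hFpi : ∀ (Q : S × A → ℝ) (sa : S × A),
      Fpi Q sa = g (r sa) (γ * Q (T sa, π (T sa))))
    (Qpi : S × A → ℝ)
    (hQpi : Fpi Qpi = Qpi)
    (hQpi_unique : ∀ Q : S × A → ℝ, Fpi Q = Q → Q = Qpi) :
    ∀ sa : S × A, Qpi sa ≤ Qstar sa := by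
  obtain ⟨m, hm⟩ := Finite.exists_max (fun sa => Qpi sa - Qstar sa)
  -- It suffices to bound the maximal gap, which a contraction forces to be nonpositive.
  suffices h : Qpi m ≤ Qstar m from fun sa => by linarith [hm sa]
  have hpi : Qpi m = g (r m) (γ * Qpi (T m, π (T m))) := by rw [← hFpi, hQpi]
  have hstar := hFstar Qstar m
  rw [hQstar] at hstar
  have hsup : Qstar (T m, π (T m)) ≤
      univ.sup' univ_nonempty (fun a' => Qstar (T m, a')) :=
    le_sup' (fun a' => Qstar (T m, a')) (mem_univ (π (T m)))
  set M := univ.sup' univ_nonempty (fun a' => Qstar (T m, a'))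
  rcases le_total (γ * Qpi (T m, π (T m))) (γ * M) with hle | hle
  · rw [hpi, hstar]
    exact hg2 _ _ _ hle
  · have hlip := hg1 (r m) (γ * Qpi (T m, π (T m))) (γ * M)
    rw [← hpi, ← hstar, abs_of_nonneg (sub_nonneg.mpr hle)] at hlip
    have hgap : γ * (Qpi (T m, π (T m)) - M) ≤ γ * (Qpi m - Qstar m) :=
      mul_le_mul_of_nonneg_left (by linarith [hm (T m, π (T m))]) hγ.1.le
    by_contra! hlt
    nlinarith [le_abs_self (Qpi m - Qstar m), hγ.2]
end

section
/- Suppose g : ℝ → ℝ → ℝ satisfies both: (i) for all a, b, c ∈ ℝ, |g(a,b) − g(a,c)| ≤ |b − c|, and (ii) for all a, b, c ∈ ℝ, if b ≥ c then g(a,b) ≥ g(a,c). Let Q* be the unique fixed point of the generalized Bellman optimality operator F*, and let π* : S → A be a greedy policy with respect to Q*, i.e., Q*(s, π*(s)) = max_{a ∈ A} Q*(s, a) for every state s. Then Q* is the unique fixed point of the policy evaluation operator F^{π*}; that is, the greedy policy attains the optimal value function. -/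
open Finset

theorem greedy_policy_attains_optimal_value
    {S A : Type*} [Fintype S] [Nonempty S] [Fintype A] [Nonempty A]
    (r : S × A → ℝ) (T : S × A → S)
    (γ : ℝ) (hγ : γ ∈ Set.Ioo (0 : ℝ) 1)
    (g : ℝ → ℝ → ℝ)
    (hg1 : ∀ a b c : ℝ, |g a b - g a c| ≤ |b - c|)
    (hg2 : ∀ a b c : ℝ, b ≥ c → g a b ≥ g a c)
    (Fstar : (S × A → ℝ) → (S × A → ℝ))
    (hFstar : ∀ (Q : S × A → ℝ) (sa : S × A),
      Fstar Q sa = g (r sa) (γ * univ.sup' univ_nonempty (fun a' => Q (T sa, a'))))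
    (Qstar : S × A → ℝ)
    (hQstar : Fstar Qstar = Qstar)
    (hQstar_unique : ∀ Q : S × A → ℝ, Fstar Q = Q → Q = Qstar)
    (πstar : S → A)
    (hgreedy : ∀ s : S, Qstar (s, πstar s) = univ.sup' univ_nonempty (fun a => Qstar (s, a)))
    (Fpistar : (S × A → ℝ) → (S × A → ℝ))
    (hFpistar : ∀ (Q : S × A → ℝ) (sa : S × A),
      Fpistar Q sa = g (r sa) (γ * Q (T sa, πstar (T sa)))) :
    Fpistar Qstar = Qstar ∧ ∀ Q : S × A → ℝ, Fpistar Q = Q → Q = Qstar := by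
  have hfix : Fpistar Qstar = Qstar := by
    funext sa
    rw [hFpistar, hgreedy, ← hFstar, hQstar]
  refine ⟨hfix, fun Q hQ => ?_⟩
  obtain ⟨m, hm⟩ := Finite.exists_max fun sa => |Q sa - Qstar sa|
  have hcontr : |Q m - Qstar m| ≤ γ * |Q m - Qstar m| :=
    calc |Q m - Qstar m| = |Fpistar Q m - Fpistar Qstar m| := by rw [hQ, hfix]
      _ ≤ |γ * Q (T m, πstar (T m)) - γ * Qstar (T m, πstar (T m))| := by
        rw [hFpistar, hFpistar]
        exact hg1 _ _ _
      _ = γ * |Q (T m, πstar (T m)) - Qstar (T m, πstar (T m))| := by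
        rw [← mul_sub, abs_mul, abs_of_pos hγ.1]
      _ ≤ γ * |Q m - Qstar m| := mul_le_mul_of_nonneg_left (hm _) hγ.1.le
  have hzero : |Q m - Qstar m| ≤ 0 := by
    nlinarith [abs_nonneg (Q m - Qstar m), hγ.2]
  funext sa
  exact sub_eq_zero.mp (abs_nonpos_iff.mp ((hm sa).trans hzero))
end

section
/- Consider a finite deterministic MDP with reward function r : S × A → ℝ, transition function T : S × A → S, and discount factor γ ∈ (0,1), with the bottleneck Bellman operator (FQ)(s,a) = min(r(s,a), γ · max_{a' ∈ A} Q(T(s,a), a')) and its unique fixed point Q*. Then any greedy policy π* with Q*(s, π*(s)) = max_{a ∈ A} Q*(s,a) for all s satisfies: Q* is the unique fixed point of the bottleneck policy evaluation operator (F^{π*}Q)(s,a) = min(r(s,a), γ · Q(T(s,a), π*(T(s,a)))), and for every deterministic policy π : S → A, the unique fixed point Q^π of (F^π Q)(s,a) = min(r(s,a), γ · Q(T(s,a), π(T(s,a)))) satisfies Q^π(s,a) ≤ Q*(s,a) for all (s,a). -/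
open Finset

/-- Comparison principle for the bottleneck evaluation operator
`Q ↦ min r (γ * Q ∘ σ)` on a finite type: every subsolution lies below every supersolution. -/
theorem le_of_bottleneck_sub_super {X : Type*} [Finite X] {γ : ℝ} (hγ : γ ∈ Set.Ioo (0 : ℝ) 1)
    (r : X → ℝ) (σ : X → X) {Q₁ Q₂ : X → ℝ}
    (h₁ : ∀ x, Q₁ x ≤ min (r x) (γ * Q₁ (σ x)))
    (h₂ : ∀ x, min (r x) (γ * Q₂ (σ x)) ≤ Q₂ x) (x : X) : Q₁ x ≤ Q₂ x := by
  have : Nonempty X := ⟨x⟩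
  obtain ⟨m, hm⟩ := Finite.exists_max fun y => Q₁ y - Q₂ y
  suffices Q₁ m ≤ Q₂ m by linarith [hm x]
  by_contra! hlt
  obtain ⟨hr, hq⟩ := le_min_iff.1 (h₁ m)
  rcases min_le_iff.1 (h₂ m) with h | h
  · linarith
  · nlinarith [mul_le_mul_of_nonneg_left (hm (σ m)) hγ.1.le, hγ.2]

theorem bottleneck_greedy_policy_global_optimality
    {S A : Type*} [Fintype S] [Nonempty S] [Fintype A] [Nonempty A]
    (r : S × A → ℝ) (T : S × A → S)
    (γ : ℝ) (hγ : γ ∈ Set.Ioo (0 : ℝ) 1)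
    (F : (S × A → ℝ) → (S × A → ℝ))
    (hF : ∀ (Q : S × A → ℝ) (sa : S × A),
      F Q sa = min (r sa) (γ * univ.sup' univ_nonempty (fun a' => Q (T sa, a'))))
    (Qstar : S × A → ℝ)
    (hQstar : F Qstar = Qstar)
    (hQstar_unique : ∀ Q : S × A → ℝ, F Q = Q → Q = Qstar)
    (πstar : S → A)
    (hgreedy : ∀ s : S, Qstar (s, πstar s) = univ.sup' univ_nonempty (fun a => Qstar (s, a)))
    (Fpistar : (S × A → ℝ) → (S × A → ℝ))
    (hFpistar : ∀ (Q : S × A → ℝ) (sa : S × A),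
      Fpistar Q sa = min (r sa) (γ * Q (T sa, πstar (T sa)))) :
    (Fpistar Qstar = Qstar ∧ ∀ Q : S × A → ℝ, Fpistar Q = Q → Q = Qstar) ∧
    (∀ (π : S → A) (Fpi : (S × A → ℝ) → (S × A → ℝ)),
      (∀ (Q : S × A → ℝ) (sa : S × A),
        Fpi Q sa = min (r sa) (γ * Q (T sa, π (T sa)))) →
      ∀ Qpi : S × A → ℝ, Fpi Qpi = Qpi →
        (∀ Q : S × A → ℝ, Fpi Q = Q → Q = Qpi) →
        ∀ sa : S × A, Qpi sa ≤ Qstar sa) := by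
  have hfix : Fpistar Qstar = Qstar := by
    funext sa
    rw [hFpistar, hgreedy, ← hF, hQstar]
  refine ⟨⟨hfix, fun Q hQ => ?_⟩, fun π Fpi hFpi Qpi hQpi _ => ?_⟩
  · have eval_eq : ∀ {Q : S × A → ℝ}, Fpistar Q = Q →
        ∀ sa, Q sa = min (r sa) (γ * Q (T sa, πstar (T sa))) :=
      fun h sa => (congrFun h sa).symm.trans (hFpistar _ sa)
    have le_of_fixed : ∀ {Q Q' : S × A → ℝ}, Fpistar Q = Q → Fpistar Q' = Q' → ∀ sa, Q sa ≤ Q' sa :=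
      fun h h' => le_of_bottleneck_sub_super hγ r (fun sa => (T sa, πstar (T sa)))
        (fun sa => (eval_eq h sa).le) (fun sa => (eval_eq h' sa).ge)
    exact le_antisymm (le_of_fixed hQ hfix) (le_of_fixed hfix hQ)
  · refine le_of_bottleneck_sub_super hγ r (fun sa => (T sa, π (T sa))) (fun sa => ?_)
      (fun sa => ?_)
    · rw [← hFpi, hQpi]
    · calc min (r sa) (γ * Qstar (T sa, π (T sa))) ≤ F Qstar sa := by
            rw [hF]
            exact min_le_min_left _ (mul_le_mul_of_nonneg_left
              (le_sup' (fun a => Qstar (T sa, a)) (mem_univ _)) hγ.1.le)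
        _ = Qstar sa := by rw [hQstar]
end
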